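/- Let G be a nontrivial finite simple connected graph of order n and diameter d, and let f'(n,d) denote the smallest positive integer k such that k + C(k + d − 1, d − 1) ≥ n. If dim(G) < f'(n,d), then dim_ms(G) > dim(G). -/

import Mathlib

/-- The multiset representation of `u` with respect to `S`: the multiset of
graph distances from `u` to the elements of `S`, counted with multiplicity. -/
noncomputable def mrep {V : Type*} (G : SimpleGraph V) (u : V) (S : Finset V) : Multiset ℕ :=
  S.val.map (G.dist u)

/-- `S` is an outer multiset resolving set of `G`. -/
def outerMResolving {V : Type*} (G : SimpleGraph V) (S : Finset V) : Prop :=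
  ∀ u v : V, u ∉ S → v ∉ S → mrep G u S = mrep G v S → u = v

/-- The outer multiset dimension of `G`. -/
noncomputable def dimMS {V : Type*} [Fintype V] (G : SimpleGraph V) : ℕ :=
  sInf {k | ∃ S : Finset V, outerMResolving G S ∧ S.card = k}

/-- `S` is a (metric) resolving set of `G`. -/
def resolving {V : Type*} (G : SimpleGraph V) (S : Finset V) : Prop :=
  ∀ u v : V, u ≠ v → ∃ w ∈ S, G.dist u w ≠ G.dist v w

/-- The metric dimension of `G`. -/
noncomputable def metricDim {V : Type*} [Fintype V] (G : SimpleGraph V) : ℕ :=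
  sInf {k | ∃ S : Finset V, resolving G S ∧ S.card = k}

/-- The diameter of a finite graph: the largest distance between two vertices. -/
noncomputable def gdiam {V : Type*} [Fintype V] (G : SimpleGraph V) : ℕ :=
  Finset.univ.sup fun p : V × V => G.dist p.1 p.2

/-- `f'(n,d)`: the smallest positive integer `k` such that `k + C(k+d-1, d-1) ≥ n`. -/
noncomputable def fprime (n d : ℕ) : ℕ :=
  sInf {k | 0 < k ∧ n ≤ k + (k + d - 1).choose (d - 1)}

theorem exists_outerMResolving_card_eq_dimMS {V : Type*} [Fintype V] (G : SimpleGraph V) :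
    ∃ S : Finset V, outerMResolving G S ∧ S.card = dimMS G :=
  Nat.sInf_mem (s := {k | ∃ S : Finset V, outerMResolving G S ∧ S.card = k})
    ⟨_, Finset.univ, fun u _ hu => absurd (Finset.mem_univ u) hu, rfl⟩

theorem outerMResolving.card_pos {V : Type*} [Fintype V] {G : SimpleGraph V} {S : Finset V}
    (hS : outerMResolving G S) (hV : 1 < Fintype.card V) : 0 < S.card := by
  obtain ⟨u, v, huv⟩ := Fintype.exists_pair_of_one_lt_card hV
  rw [Finset.card_pos, Finset.nonempty_iff_ne_empty]
  rintro rfl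
  exact huv (hS u v (Finset.notMem_empty u) (Finset.notMem_empty v) rfl)

theorem dist_le_gdiam {V : Type*} [Fintype V] (G : SimpleGraph V) (u v : V) :
    G.dist u v ≤ gdiam G :=
  Finset.le_sup (f := fun p : V × V => G.dist p.1 p.2) (Finset.mem_univ (u, v))

theorem gdiam_pos {V : Type*} [Fintype V] {G : SimpleGraph V} (hG : G.Connected)
    (hV : 1 < Fintype.card V) : 0 < gdiam G := by
  obtain ⟨u, v, huv⟩ := Fintype.exists_pair_of_one_lt_card hV
  exact (hG.pos_dist_of_ne huv).trans_le (dist_le_gdiam G u v)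

/-- The distances from outside `S` to `S` lie in `{1, …, d}`, so there are at most
`C(|S|+d-1, d-1)` multiset representations with respect to `S`. -/
theorem outerMResolving.card_le {V : Type*} [Fintype V] {G : SimpleGraph V} (hG : G.Connected)
    {S : Finset V} (hS : outerMResolving G S) (hd : 0 < gdiam G) :
    Fintype.card V ≤ S.card + (S.card + gdiam G - 1).choose (gdiam G - 1) := by
  classical
  have : NeZero (gdiam G) := ⟨hd.ne'⟩
  let r (u : V) : Multiset (Fin (gdiam G)) :=
    S.val.map fun w => Fin.ofNat (gdiam G) (G.dist u w - 1)
  have hr : ∀ u ∉ S, (r u).map (fun i : Fin (gdiam G) => (i : ℕ) + 1) = mrep G u S := by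
    intro u hu
    rw [Multiset.map_map]
    refine Multiset.map_congr rfl fun w hw => ?_
    have hpos : 0 < G.dist u w := hG.pos_dist_of_ne fun h => hu (h ▸ hw)
    have hle := dist_le_gdiam G u w
    simp only [Function.comp_apply, Fin.val_ofNat]
    rw [Nat.mod_eq_of_lt (by omega)]
    omega
  have hle : Sᶜ.card ≤ (Finset.univ : Finset (Sym (Fin (gdiam G)) S.card)).card := by
    refine Finset.card_le_card_of_injOn (fun u => Sym.mk (r u) (by simp [r]))
      (fun _ _ => Finset.mem_univ _) fun u hu v hv h => ?_
    have hu : u ∉ S := by simpa using hu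
    have hv : v ∉ S := by simpa using hv
    exact hS u v hu hv (by rw [← hr u hu, ← hr v hv, show r u = r v from congrArg Subtype.val h])
  rw [Finset.card_univ, Sym.card_sym_eq_choose, Fintype.card_fin, add_comm (gdiam G),
    Nat.choose_symm_of_eq_add (b := gdiam G - 1) (by omega)] at hle
  rw [← Finset.card_add_card_compl S]
  omega

/-- If a nontrivial finite connected graph `G` of order `n` and diameter `d` satisfies
`dim(G) < f'(n,d)`, then `dim_ms(G) > dim(G)`. -/
theorem dimMS_gt_dim_of_dim_lt_fprime
    {V : Type*} [Fintype V] (G : SimpleGraph V) (n d : ℕ)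
    (hn : n = Fintype.card V) (hV : 1 < Fintype.card V) (hG : G.Connected)
    (hd : d = gdiam G)
    (hdim : metricDim G < fprime n d) :
    metricDim G < dimMS G := by
  obtain ⟨S, hS, hcard⟩ := exists_outerMResolving_card_eq_dimMS G
  subst hn hd
  rw [← hcard]
  exact hdim.trans_le (Nat.sInf_le ⟨hS.card_pos hV, hS.card_le hG (gdiam_pos hG hV)⟩)
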